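/- For every integer α ≥ 1, the ring homomorphism φ^α : R/I^α → S/𝔞^α S induced by φ (which satisfies φ(I^α) ⊆ 𝔞^α S) is injective. -/

import Mathlib

open CategoryTheory Opposite MvPowerSeries

set_option synthInstance.maxHeartbeats 1000000
set_option maxHeartbeats 1000000

noncomputable section

/-- The grade of an ideal: the maximal length of a regular sequence contained in it. -/
def idealGrade {A : Type} [CommRing A] (J : Ideal A) : ℕ∞ :=
  sSup {c : ℕ∞ | ∃ rs : List A, (∀ r ∈ rs, r ∈ J) ∧
    RingTheory.Sequence.IsRegular A rs ∧ (rs.length : ℕ∞) = c}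

/-- The height of an ideal: the infimum of heights of primes containing it. -/
def idealHeight {A : Type} [CommRing A] (J : Ideal A) : ℕ∞ :=
  sInf {h : ℕ∞ | ∃ p : PrimeSpectrum A, J ≤ p.asIdeal ∧ Order.height p = h}

/-- A canonical module of a `d`-dimensional local ring `A`: a finitely generated module `ω`
with `Ext_A^i(𝕜, ω) = 0` for `i ≠ d` and `Ext_A^d(𝕜, ω)` a one-dimensional `𝕜`-vector space
(equivalently, isomorphic to `𝕜` as an `A`-module), where `𝕜` is the residue field. -/
def IsCanonicalModule (A : Type) [CommRing A] [IsLocalRing A] (d : ℕ)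
    (ω : ModuleCat A) : Prop :=
  Module.Finite A ω ∧
  (∀ i : ℕ, i ≠ d → Subsingleton
    (((Ext A (ModuleCat A) i).obj
      (op (ModuleCat.of A (IsLocalRing.ResidueField A)))).obj ω)) ∧
  Nonempty ((((Ext A (ModuleCat A) d).obj
      (op (ModuleCat.of A (IsLocalRing.ResidueField A)))).obj ω)
    ≃ₗ[A] IsLocalRing.ResidueField A)

variable (𝕜 : Type) [Field 𝕜] (m n : ℕ)

/-- The formal power series ring `P` in the entries of an `m × n` matrix of variables. -/
abbrev DetP := MvPowerSeries (Fin m × Fin n) 𝕜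

/-- The ideal of `P` generated by the `2 × 2` minors of the matrix of variables. -/
def detI2 : Ideal (DetP 𝕜 m n) :=
  Ideal.span {f | ∃ (i k : Fin m) (j l : Fin n), i < k ∧ j < l ∧
    f = X (i, j) * X (k, l) - X (i, l) * X (k, j)}

/-- The complete determinantal ring `R = P/I₂(X)`. -/
abbrev DetR := DetP 𝕜 m n ⧸ detI2 𝕜 m n

/-- The residue class in `R` of the variable `x_{ij}`. -/
def detx (i : Fin m) (j : Fin n) : DetR 𝕜 m n :=
  Ideal.Quotient.mk (detI2 𝕜 m n) (X (i, j))

/-- The ideal `I` of `R` generated by the entries of the first `n - 1` columns. -/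
def detJ : Ideal (DetR 𝕜 m n) :=
  Ideal.span {x | ∃ (i : Fin m) (j : Fin n), (j : ℕ) < n - 1 ∧ x = detx 𝕜 m n i j}

/-- The formal power series ring `S = 𝕜[[x_1, …, x_m, a_1, …, a_{n-1}]]`. -/
abbrev DetS := MvPowerSeries (Fin m ⊕ Fin (n - 1)) 𝕜

/-- The ideal `𝔞 = (a_1, …, a_{n-1})S`. -/
def detA : Ideal (DetS 𝕜 m n) :=
  Ideal.span {f | ∃ j : Fin (n - 1), f = X (Sum.inr j)}

/-- The property pinning down the local `𝕜`-algebra homomorphism `φ : R → S`: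
`x_{ij} ↦ a_j·x_i` for `1 ≤ j ≤ n-1` and `x_{in} ↦ x_i` (in `0`-based indexing, the last
column is `j = n-1`).  Any `𝕜`-algebra homomorphism `R → S` with these values on the
variables automatically maps the maximal ideal into the maximal ideal, hence is continuous
and is uniquely determined by these values; so this predicate characterizes `φ`. -/
def IsDetPhi (φ : DetR 𝕜 m n →ₐ[𝕜] DetS 𝕜 m n) : Prop :=
  ∀ (i : Fin m) (j : Fin n),
    φ (detx 𝕜 m n i j) =
      if h : (j : ℕ) < n - 1 then X (Sum.inr (⟨j, h⟩ : Fin (n - 1))) * X (Sum.inl i)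
      else X (Sum.inl i)

/-- The ideal of power series whose coefficients vanish at exponents of weight less than `k`. -/
def weightIdeal {σ : Type*} (K : Type*) [Field K] (w : (σ →₀ ℕ) →+ ℕ) (k : ℕ) :
    Ideal (MvPowerSeries σ K) where
  carrier := {f | ∀ d, w d < k → coeff d f = 0}
  zero_mem' := fun d _ => by simp
  add_mem' := fun {f g} hf hg d hd => by simp [hf d hd, hg d hd]
  smul_mem' := fun c f hf d hd => by
    classical
    rw [smul_eq_mul, coeff_mul]
    refine Finset.sum_eq_zero fun p hp => ?_
    rw [Finset.HasAntidiagonal.mem_antidiagonal] at hp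
    have : w d = w p.1 + w p.2 := by rw [← hp, map_add]
    rw [hf p.2 (by omega), mul_zero]

/-- The ideal generated by the variables. -/
def varIdeal (σ K : Type*) [Field K] : Ideal (MvPowerSeries σ K) :=
  Ideal.span (Set.range X)

lemma weightIdeal_mul_le {σ K : Type*} [Field K] (w : (σ →₀ ℕ) →+ ℕ) (j k : ℕ) :
    weightIdeal K w j * weightIdeal K w k ≤ weightIdeal K w (j + k) := by
  classical
  rw [Ideal.mul_le]
  intro f hf g hg d hd
  rw [coeff_mul]
  refine Finset.sum_eq_zero fun p hp => ?_
  rw [Finset.HasAntidiagonal.mem_antidiagonal] at hp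
  have : w d = w p.1 + w p.2 := by rw [← hp, map_add]
  by_cases h : w p.1 < j
  · rw [hf p.1 h, zero_mul]
  · rw [hg p.2 (by omega), mul_zero]

lemma pow_le_weightIdeal {σ K : Type*} [Field K] (w : (σ →₀ ℕ) →+ ℕ)
    {J : Ideal (MvPowerSeries σ K)} (hJ : J ≤ weightIdeal K w 1) (k : ℕ) :
    J ^ k ≤ weightIdeal K w k := by
  induction k with
  | zero => exact fun f _ d hd => absurd hd (Nat.not_lt_zero _)
  | succ k ih =>
    rw [pow_succ]
    exact (Ideal.mul_mono ih hJ).trans (weightIdeal_mul_le w k 1)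

lemma monomial_mem_weightIdeal {σ K : Type*} [Field K] (w : (σ →₀ ℕ) →+ ℕ) {e : σ →₀ ℕ} {k : ℕ}
    (h : k ≤ w e) : monomial e (1 : K) ∈ weightIdeal K w k := by
  classical
  intro d hd
  refine coeff_monomial_ne ?_ _
  rintro rfl
  omega

lemma varIdeal_le_weightIdeal {σ K : Type*} [Field K] :
    varIdeal σ K ≤ weightIdeal K Finsupp.degree 1 := by
  rw [varIdeal, Ideal.span_le]
  rintro _ ⟨i, rfl⟩
  exact monomial_mem_weightIdeal _ (by rw [Finsupp.degree_single])

lemma coeff_eq_zero_of_mem_varIdeal_pow {σ K : Type*} [Field K] {k : ℕ} {f : MvPowerSeries σ K}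
    (hf : f ∈ varIdeal σ K ^ k) {d : σ →₀ ℕ} (hd : d.degree < k) : coeff d f = 0 :=
  pow_le_weightIdeal _ varIdeal_le_weightIdeal k hf d hd

lemma X_mem_varIdeal {σ K : Type*} [Field K] (i : σ) : (X i : MvPowerSeries σ K) ∈ varIdeal σ K :=
  Ideal.subset_span ⟨i, rfl⟩

lemma monomial_mem_varIdeal_pow {σ K : Type*} [Field K] (e : σ →₀ ℕ) :
    monomial e (1 : K) ∈ varIdeal σ K ^ e.degree := by
  induction e using Finsupp.induction_linear with
  | zero => simp
  | add f g hf hg =>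
    rw [map_add, pow_add, ← one_mul (1 : K), ← monomial_mul_monomial]
    exact Ideal.mul_mem_mul hf hg
  | single i a =>
    rw [Finsupp.degree_single, ← X_pow_eq]
    exact Ideal.pow_mem_pow (X_mem_varIdeal i) a

/-- The finite set of exponents of degree less than `k`. -/
def expBelow (σ : Type*) [Finite σ] (k : ℕ) : Finset (σ →₀ ℕ) :=
  (Finsupp.finite_of_degree_lt k).toFinset

lemma mem_expBelow {σ : Type*} [Finite σ] {k : ℕ} {e : σ →₀ ℕ} :
    e ∈ expBelow σ k ↔ e.degree < k := by
  simp [expBelow]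

/-- A finitely generated ideal contains the sum of a family of its elements which converges
fast enough: if `q e` lies in `𝔪 ^ (|e| - c) * A` then `∑ a e • q e` lies in `A`. -/
lemma mem_of_coeff_eq_sum {σ K : Type*} [Finite σ] [Field K] {A : Ideal (MvPowerSeries σ K)}
    (hA : A.FG) (c : ℕ) (a : (σ →₀ ℕ) → K) (q : (σ →₀ ℕ) → MvPowerSeries σ K)
    (hq : ∀ e, q e ∈ varIdeal σ K ^ (e.degree - c) * A) (F : MvPowerSeries σ K)
    (hF : ∀ d, ∃ k, d.degree + c < k ∧ coeff d F = ∑ e ∈ expBelow σ k, a e * coeff d (q e)) :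
    F ∈ A := by
  classical
  obtain ⟨s, rfl⟩ := hA
  have hp : ∀ e, ∃ p : s → MvPowerSeries σ K, (∀ t, p t ∈ varIdeal σ K ^ (e.degree - c)) ∧
      q e = ∑ t, p t * t.1 := by
    intro e
    have h := hq e
    rw [← smul_eq_mul, ← Subtype.range_coe (s := (s : Set (MvPowerSeries σ K))),
      Submodule.mem_ideal_smul_span_iff_exists_sum] at h
    obtain ⟨p, hp, hsum⟩ := h
    refine ⟨p, hp, ?_⟩
    rw [← hsum, Finsupp.sum_fintype _ _ (by simp)]
    rfl
  choose p hpm hps using hp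
  have hvan : ∀ e t d, d.degree + c < e.degree → coeff d (p e t) = 0 := fun e t d h =>
    coeff_eq_zero_of_mem_varIdeal_pow (hpm e t) (by omega)
  let H : s → MvPowerSeries σ K := fun t d =>
    ∑ e ∈ expBelow σ (d.degree + c + 1), a e * coeff d (p e t)
  have hH : ∀ t d k, d.degree + c < k →
      coeff d (H t) = ∑ e ∈ expBelow σ k, a e * coeff d (p e t) := by
    intro t d k hk
    change ∑ e ∈ expBelow σ (d.degree + c + 1), a e * coeff d (p e t) = _
    refine Finset.sum_subset (fun e he => ?_) (fun e _ he => ?_)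
    · rw [mem_expBelow] at he ⊢
      omega
    · rw [mem_expBelow] at he
      rw [hvan e t d (by omega), mul_zero]
  have hFH : F = ∑ t, H t * t.1 := by
    ext d
    obtain ⟨k, hk, hd⟩ := hF d
    rw [hd, map_sum]
    simp_rw [hps, map_sum, coeff_mul, Finset.mul_sum]
    rw [Finset.sum_comm]
    refine Finset.sum_congr rfl fun t _ => ?_
    rw [Finset.sum_comm]
    refine Finset.sum_congr rfl fun x hx => ?_
    rw [Finset.HasAntidiagonal.mem_antidiagonal] at hx
    have : d.degree = x.1.degree + x.2.degree := by rw [← hx, map_add]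
    rw [hH t x.1 k (by omega), Finset.sum_mul]
    exact Finset.sum_congr rfl fun e _ => by ring
  rw [hFH]
  exact Ideal.sum_mem _ fun t _ => Ideal.mul_mem_left _ _ (Submodule.subset_span t.2)

lemma varIdeal_fg (σ K : Type*) [Finite σ] [Field K] : (varIdeal σ K).FG :=
  Submodule.fg_span (Set.finite_range _)

lemma mem_varIdeal_pow {σ K : Type*} [Finite σ] [Field K] {k : ℕ} {F : MvPowerSeries σ K}
    (hF : ∀ d : σ →₀ ℕ, d.degree < k → coeff d F = 0) : F ∈ varIdeal σ K ^ k := by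
  classical
  refine mem_of_coeff_eq_sum ((varIdeal_fg σ K).pow) k (fun e => coeff e F)
    (fun e => if k ≤ e.degree then monomial e 1 else 0) (fun e => ?_) F fun d =>
      ⟨d.degree + k + 1, by omega, ?_⟩
  · show ite _ _ _ ∈ _
    split_ifs with h
    · rw [← pow_add, Nat.sub_add_cancel h]
      exact monomial_mem_varIdeal_pow e
    · exact zero_mem _
  · rw [Finset.sum_eq_single d]
    · split_ifs with h
      · simp
      · simp [hF d (by omega)]
    · intro e _ he
      split_ifs
      · rw [coeff_monomial_ne he.symm, mul_zero]
      · simp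
    · intro h
      exact absurd (mem_expBelow.2 (by omega)) h

/-- Coefficients of the image of a power series under a homomorphism sending every variable to a
monomial are given by summing over the fibres of the map on exponents. -/
lemma coeff_map_eq_sum {σ τ K : Type*} [Finite σ] [DecidableEq (τ →₀ ℕ)] [Field K]
    (ψ : MvPowerSeries σ K →ₐ[K] MvPowerSeries τ K) (θ : (σ →₀ ℕ) →+ (τ →₀ ℕ))
    (hψ : ∀ e, ψ (monomial e 1) = monomial (θ e) 1)
    (hθ : ∀ i, 1 ≤ (θ (Finsupp.single i 1)).degree) (f : MvPowerSeries σ K) {t : τ →₀ ℕ} {k : ℕ}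
    (hk : t.degree < k) :
    coeff t (ψ f) = ∑ e ∈ expBelow σ k, if θ e = t then coeff e f else 0 := by
  classical
  set g : MvPowerSeries σ K := ∑ e ∈ expBelow σ k, coeff e f • monomial e 1 with hg
  have hfg : f - g ∈ varIdeal σ K ^ k := by
    refine mem_varIdeal_pow fun d hd => ?_
    rw [map_sub, hg, map_sum, Finset.sum_eq_single d]
    · simp
    · intro e _ he
      rw [map_smul, coeff_monomial_ne he.symm, smul_zero]
    · intro h
      exact absurd (mem_expBelow.2 hd) h
  have hle : varIdeal σ K ≤ (weightIdeal K (σ := τ) Finsupp.degree 1).comap ψ := by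
    rw [varIdeal, Ideal.span_le]
    rintro _ ⟨i, rfl⟩
    change ψ (monomial (Finsupp.single i 1) 1) ∈ weightIdeal K Finsupp.degree 1
    rw [hψ]
    exact monomial_mem_weightIdeal _ (hθ i)
  have h0 : coeff t (ψ (f - g)) = 0 := by
    have := (Ideal.pow_right_mono hle k).trans (Ideal.le_comap_pow _ k) hfg
    exact pow_le_weightIdeal _ le_rfl k this t hk
  rw [map_sub, map_sub, sub_eq_zero] at h0
  rw [h0, hg, map_sum, map_sum]
  refine Finset.sum_congr rfl fun e _ => ?_
  rw [map_smul, hψ, map_smul, coeff_monomial, smul_eq_mul]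
  simp [eq_comm]

lemma exists_eq_single_add {σ : Type*} {e : σ →₀ ℕ} {p : σ} (h : 0 < e p) :
    ∃ r, e = Finsupp.single p 1 + r :=
  ⟨e - Finsupp.single p 1, (add_tsub_cancel_of_le (Finsupp.single_le_iff.2 h)).symm⟩

/-- Two monomials in the entries of a matrix whose exponents have the same row and column sums
are congruent modulo any ideal containing the `2 × 2` minors. -/
lemma monomial_sub_monomial_mem {ι κ K : Type*} [Fintype ι] [Fintype κ] [Field K]
    {A : Ideal (MvPowerSeries (ι × κ) K)}
    (hA : ∀ i k j l, X (i, j) * X (k, l) - X (i, l) * X (k, j) ∈ A) (N : ℕ) :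
    ∀ e e' : ι × κ →₀ ℕ, e.degree = N → (∀ i, ∑ j, e (i, j) = ∑ j, e' (i, j)) →
      (∀ j, ∑ i, e (i, j) = ∑ i, e' (i, j)) →
      monomial e 1 - monomial e' 1 ∈ varIdeal (ι × κ) K ^ (N - 2) * A := by
  classical
  induction N with
  | zero =>
    intro e e' he hr _
    have h0 : e = 0 := (Finsupp.degree_eq_zero_iff e).1 he
    have h1 : e' = 0 := by
      ext ⟨i, j⟩
      have := hr i
      simp only [h0, Finsupp.coe_zero, Pi.zero_apply, Finset.sum_const_zero] at this
      exact (Finset.sum_eq_zero_iff.1 this.symm) j (Finset.mem_univ j)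
    rw [h0, h1, sub_self]
    exact zero_mem _
  | succ N ih =>
    have common : ∀ (p : ι × κ) (e e' : ι × κ →₀ ℕ), e.degree = N + 1 →
        (∀ i, ∑ j, e (i, j) = ∑ j, e' (i, j)) → (∀ j, ∑ i, e (i, j) = ∑ i, e' (i, j)) →
        0 < e p → 0 < e' p →
        monomial e 1 - monomial e' 1 ∈ varIdeal (ι × κ) K ^ (N + 1 - 2) * A := by
      intro p e e' he hr hc hp hp'
      obtain ⟨r, rfl⟩ := exists_eq_single_add hp
      obtain ⟨r', rfl⟩ := exists_eq_single_add hp'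
      have h := ih r r' (by rw [map_add, Finsupp.degree_single] at he; omega)
        (fun i => by simpa [Finset.sum_add_distrib] using hr i)
        (fun j => by simpa [Finset.sum_add_distrib] using hc j)
      rw [← one_mul (1 : K), ← monomial_mul_monomial, ← monomial_mul_monomial, ← mul_sub]
      have h2 := Ideal.mul_mem_mul (X_mem_varIdeal (K := K) p) h
      rw [← mul_assoc, ← pow_succ'] at h2
      exact Ideal.mul_mono_left (Ideal.pow_le_pow_right (by omega)) h2
    intro e e' he hr hc
    have hne : ∃ p, 0 < e p := by
      by_contra! h
      have : e = 0 := by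
        ext p
        exact Nat.le_zero.1 (h p)
      rw [this, map_zero] at he
      omega
    obtain ⟨⟨i, j⟩, hij⟩ := hne
    obtain ⟨l, hl⟩ : ∃ l, 0 < e' (i, l) := by
      have : 0 < ∑ l, e' (i, l) := by
        rw [← hr i]
        exact Finset.sum_pos' (fun _ _ => Nat.zero_le _) ⟨j, Finset.mem_univ j, hij⟩
      simpa using (Finset.sum_pos_iff.1 this)
    obtain ⟨k, hk⟩ : ∃ k, 0 < e' (k, j) := by
      have : 0 < ∑ k, e' (k, j) := by
        rw [← hc j]
        exact Finset.sum_pos' (fun _ _ => Nat.zero_le _) ⟨i, Finset.mem_univ i, hij⟩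
      simpa using (Finset.sum_pos_iff.1 this)
    by_cases hij' : 0 < e' (i, j)
    · exact common _ e e' he hr hc hij hij'
    have hlj : l ≠ j := by rintro rfl; exact hij' hl
    have hki : k ≠ i := by rintro rfl; exact hij' hk
    have hdeg : e'.degree = N + 1 := by
      rw [← he, Finsupp.degree_eq_sum, Finsupp.degree_eq_sum, Fintype.sum_prod_type,
        Fintype.sum_prod_type]
      exact Finset.sum_congr rfl fun i _ => (hr i).symm
    obtain ⟨s, rfl⟩ := exists_eq_single_add hl
    obtain ⟨r, rfl⟩ : ∃ r, s = Finsupp.single (k, j) 1 + r := by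
      refine exists_eq_single_add ?_
      simpa [Finsupp.single_apply, hki.symm] using hk
    have hswap := common (i, j) e (Finsupp.single (i, j) 1 + (Finsupp.single (k, l) 1 + r)) he
      (fun a => by
        rw [hr a]
        simp [Finset.sum_add_distrib, Finsupp.single_apply, Prod.ext_iff, ite_and])
      (fun b => by
        rw [hc b]
        simp only [Finsupp.coe_add, Pi.add_apply, Finset.sum_add_distrib, Finsupp.single_apply,
          Prod.mk.injEq, ite_and, Finset.sum_ite_eq, Finset.mem_univ, if_true]
        omega) hij (by simp)
    rw [map_add, map_add, Finsupp.degree_single, Finsupp.degree_single] at hdeg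
    have hmin := Ideal.mul_mem_mul (monomial_mem_varIdeal_pow (K := K) r) (hA i k j l)
    rw [show r.degree = N + 1 - 2 by omega] at hmin
    convert add_mem hswap hmin using 1
    simp only [X_def, mul_sub, monomial_mul_monomial, mul_one]
    rw [show r + (Finsupp.single (i, j) 1 + Finsupp.single (k, l) 1)
        = Finsupp.single (i, j) 1 + (Finsupp.single (k, l) 1 + r) by abel,
      show r + (Finsupp.single (i, l) 1 + Finsupp.single (k, j) 1)
        = Finsupp.single (i, l) 1 + (Finsupp.single (k, j) 1 + r) by abel]
    abel

/-- The map on exponents induced by `φ`: `x_{ij} ↦ a_j x_i` for `j < n - 1`, and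
`x_{ij} ↦ x_i` for the last column. -/
def detExp (m n : ℕ) : (Fin m × Fin n →₀ ℕ) →+ (Fin m ⊕ Fin (n - 1) →₀ ℕ) :=
  Finsupp.liftAddHom fun p => multiplesHom _
    ((if h : (p.2 : ℕ) < n - 1 then Finsupp.single (Sum.inr ⟨p.2, h⟩) 1 else 0) +
      Finsupp.single (Sum.inl p.1) 1)

lemma detExp_single (m n : ℕ) (p : Fin m × Fin n) (a : ℕ) :
    detExp m n (Finsupp.single p a) =
      a • ((if h : (p.2 : ℕ) < n - 1 then Finsupp.single (Sum.inr ⟨p.2, h⟩) 1 else 0) +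
        Finsupp.single (Sum.inl p.1) 1) := by
  simp [detExp]

lemma detExp_inl {m n : ℕ} (e : Fin m × Fin n →₀ ℕ) (i : Fin m) :
    detExp m n e (Sum.inl i) = ∑ j, e (i, j) := by
  classical
  induction e using Finsupp.induction_linear with
  | zero => simp
  | add f g hf hg => simp [hf, hg, Finset.sum_add_distrib]
  | single p a =>
    obtain ⟨k, l⟩ := p
    rw [detExp_single]
    split_ifs <;> simp [Finsupp.single_apply, ite_and]

lemma detExp_inr {m n : ℕ} (e : Fin m × Fin n →₀ ℕ) (j : Fin (n - 1)) :
    detExp m n e (Sum.inr j) = ∑ i, e (i, Fin.castLE (Nat.sub_le n 1) j) := by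
  classical
  induction e using Finsupp.induction_linear with
  | zero => simp
  | add f g hf hg => simp [hf, hg, Finset.sum_add_distrib]
  | single p a =>
    obtain ⟨k, l⟩ := p
    rw [detExp_single]
    split_ifs with h
    · simp only [Finsupp.smul_apply, Finsupp.add_apply, Finsupp.single_apply, Prod.mk.injEq, ite_and,
        Finset.sum_ite_eq, Finset.mem_univ, if_true]
      simp [Fin.ext_iff, eq_comm]
    · have : (l : ℕ) ≠ j := fun hl => h (hl ▸ j.2)
      simp [Fin.ext_iff, this]

lemma sum_row_eq_of_detExp_eq {m n : ℕ} {e e' : Fin m × Fin n →₀ ℕ}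
    (h : detExp m n e = detExp m n e') (i : Fin m) : ∑ j, e (i, j) = ∑ j, e' (i, j) := by
  rw [← detExp_inl, ← detExp_inl, h]

lemma sum_col_eq_of_detExp_eq {m n : ℕ} {e e' : Fin m × Fin n →₀ ℕ}
    (h : detExp m n e = detExp m n e') (j : Fin n) : ∑ i, e (i, j) = ∑ i, e' (i, j) := by
  have hlt : ∀ j : Fin n, (j : ℕ) < n - 1 → ∑ i, e (i, j) = ∑ i, e' (i, j) := fun j hj => by
    have := congrArg (fun t => t (Sum.inr (⟨j, hj⟩ : Fin (n - 1)))) h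
    simp only [detExp_inr] at this
    exact this
  by_cases hj : (j : ℕ) < n - 1
  · exact hlt j hj
  have htot : ∑ j, ∑ i, e (i, j) = ∑ j, ∑ i, e' (i, j) := by
    rw [Finset.sum_comm, Finset.sum_comm (f := fun j i => e' (i, j))]
    exact Finset.sum_congr rfl fun i _ => sum_row_eq_of_detExp_eq h i
  rw [← Finset.add_sum_erase _ _ (Finset.mem_univ j),
    ← Finset.add_sum_erase _ (fun j => ∑ i, e' (i, j)) (Finset.mem_univ j),
    Finset.sum_congr rfl fun l hl => hlt l ?_] at htot
  · exact Nat.add_right_cancel htot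
  · have := Finset.ne_of_mem_erase hl
    rw [Ne, Fin.ext_iff] at this
    omega

/-- The degree of an exponent in the variables `a_j`. -/
def aDegree (m n : ℕ) : (Fin m ⊕ Fin (n - 1) →₀ ℕ) →+ ℕ :=
  ∑ j, Finsupp.applyAddHom (Sum.inr j)

lemma aDegree_apply {m n : ℕ} (t : Fin m ⊕ Fin (n - 1) →₀ ℕ) :
    aDegree m n t = ∑ j, t (Sum.inr j) := by
  simp [aDegree]

lemma aDegree_detExp_single {m n : ℕ} (p : Fin m × Fin n) (a : ℕ) :
    aDegree m n (detExp m n (Finsupp.single p a)) = if (p.2 : ℕ) < n - 1 then a else 0 := by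
  classical
  rw [detExp_single, aDegree_apply]
  split_ifs with h <;> simp [Finsupp.single_apply]

/-- The ideal of the power series ring generated by the first `n - 1` columns of variables. -/
def colIdeal (K : Type) [Field K] (m n : ℕ) : Ideal (DetP K m n) :=
  Ideal.span {x | ∃ (i : Fin m) (j : Fin n), (j : ℕ) < n - 1 ∧ x = X (i, j)}

lemma colIdeal_le_varIdeal (K : Type) [Field K] (m n : ℕ) :
    colIdeal K m n ≤ varIdeal (Fin m × Fin n) K := by
  rw [colIdeal, Ideal.span_le]
  rintro _ ⟨i, j, -, rfl⟩
  exact X_mem_varIdeal _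

lemma colIdeal_fg (K : Type) [Field K] (m n : ℕ) : (colIdeal K m n).FG := by
  refine Submodule.fg_span ((Set.finite_range (X (R := K) (σ := Fin m × Fin n))).subset ?_)
  rintro _ ⟨i, j, -, rfl⟩
  exact ⟨_, rfl⟩

lemma detI2_fg (K : Type) [Field K] (m n : ℕ) : (detI2 K m n).FG := by
  refine Submodule.fg_span ((Set.finite_range
    (fun p : Fin m × Fin m × Fin n × Fin n => (X (p.1, p.2.2.1) * X (p.2.1, p.2.2.2) -
      X (p.1, p.2.2.2) * X (p.2.1, p.2.2.1) : DetP K m n))).subset ?_)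
  rintro _ ⟨i, k, j, l, -, -, rfl⟩
  exact ⟨(i, k, j, l), rfl⟩

lemma minor_mem_detI2 (K : Type) [Field K] {m n : ℕ} (i k : Fin m) (j l : Fin n) :
    (X (i, j) * X (k, l) - X (i, l) * X (k, j) : DetP K m n) ∈ detI2 K m n := by
  have key : ∀ (i k : Fin m) (j l : Fin n), i < k → j < l →
      (X (i, j) * X (k, l) - X (i, l) * X (k, j) : DetP K m n) ∈ detI2 K m n :=
    fun i k j l hik hjl => Ideal.subset_span ⟨i, k, j, l, hik, hjl, rfl⟩
  rcases lt_trichotomy i k with hik | rfl | hik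
  · rcases lt_trichotomy j l with hjl | rfl | hjl
    · exact key i k j l hik hjl
    · simp
    · convert neg_mem (key i k l j hik hjl) using 1
      ring
  · convert zero_mem (detI2 K m n) using 1
    ring
  · rcases lt_trichotomy j l with hjl | rfl | hjl
    · convert neg_mem (key k i j l hik hjl) using 1
      ring
    · simp
    · convert key k i l j hik hjl using 1
      ring

lemma map_colIdeal (K : Type) [Field K] (m n : ℕ) :
    (colIdeal K m n).map (Ideal.Quotient.mk (detI2 K m n)) = detJ K m n := by
  rw [colIdeal, Ideal.map_span, detJ]
  congr 1
  ext x
  constructor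
  · rintro ⟨_, ⟨i, j, hj, rfl⟩, rfl⟩
    exact ⟨i, j, hj, rfl⟩
  · rintro ⟨i, j, hj, rfl⟩
    exact ⟨_, ⟨i, j, hj, rfl⟩, rfl⟩

lemma monomial_mem_colIdeal_pow (K : Type) [Field K] {m n : ℕ} (e : Fin m × Fin n →₀ ℕ) :
    ∃ b, e.degree = b + aDegree m n (detExp m n e) ∧ monomial e (1 : K) ∈
      varIdeal (Fin m × Fin n) K ^ b * colIdeal K m n ^ aDegree m n (detExp m n e) := by
  induction e using Finsupp.induction_linear with
  | zero => exact ⟨0, by simp, by simp⟩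
  | add f g hf hg =>
    obtain ⟨b, hb, hf⟩ := hf
    obtain ⟨c, hc, hg⟩ := hg
    refine ⟨b + c, by rw [map_add, map_add, map_add, hb, hc]; ring, ?_⟩
    rw [map_add, map_add, pow_add, pow_add, ← one_mul (1 : K), ← monomial_mul_monomial,
      mul_mul_mul_comm]
    exact Ideal.mul_mem_mul hf hg
  | single p a =>
    rw [aDegree_detExp_single, Finsupp.degree_single, ← X_pow_eq]
    split_ifs with h
    · refine ⟨0, by simp, ?_⟩
      rw [pow_zero, one_mul]
      have hp : (X p : DetP K m n) ∈ colIdeal K m n := Ideal.subset_span ⟨p.1, p.2, h, rfl⟩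
      exact Ideal.pow_mem_pow hp a
    · refine ⟨a, by simp, ?_⟩
      rw [pow_zero, mul_one]
      exact Ideal.pow_mem_pow (X_mem_varIdeal p) a

lemma monomial_mem_varIdeal_pow_mul {K : Type} [Field K] {m n α : ℕ} {e : Fin m × Fin n →₀ ℕ}
    (h : α ≤ aDegree m n (detExp m n e)) : monomial e (1 : K) ∈
      varIdeal (Fin m × Fin n) K ^ (e.degree - α) * colIdeal K m n ^ α := by
  obtain ⟨b, hb, he⟩ := monomial_mem_colIdeal_pow K e
  obtain ⟨c, hc⟩ := Nat.exists_eq_add_of_le' h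
  rw [hc, pow_add, ← mul_assoc] at he
  rw [show e.degree - α = b + c by omega, pow_add]
  exact Ideal.mul_mono_left
    (Ideal.mul_mono_right (Ideal.pow_right_mono (colIdeal_le_varIdeal K m n) c)) he

lemma detA_le_weightIdeal (K : Type) [Field K] (m n : ℕ) :
    detA K m n ≤ weightIdeal K (aDegree m n) 1 := by
  classical
  rw [detA, Ideal.span_le]
  rintro _ ⟨j, rfl⟩
  exact monomial_mem_weightIdeal _ (by simp [aDegree_apply, Finsupp.single_apply])

lemma map_monomial_eq_monomial_detExp {K : Type} [Field K] {m n : ℕ}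
    (φ : DetR K m n →ₐ[K] DetS K m n) (hφ : IsDetPhi K m n φ) (e : Fin m × Fin n →₀ ℕ) :
    φ.comp (Ideal.Quotient.mkₐ K (detI2 K m n)) (monomial e 1) = monomial (detExp m n e) 1 := by
  induction e using Finsupp.induction_linear with
  | zero => simp
  | add f g hf hg =>
    rw [← one_mul (1 : K), ← monomial_mul_monomial, map_mul, hf, hg, monomial_mul_monomial,
      ← map_add]
  | single p a =>
    have h1 : φ.comp (Ideal.Quotient.mkₐ K (detI2 K m n)) (X p) =
        monomial (detExp m n (Finsupp.single p 1)) 1 := by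
      refine (hφ p.1 p.2).trans ?_
      rw [detExp_single]
      split_ifs
      · rw [X_def, X_def, monomial_mul_monomial, one_smul, one_mul]
      · rw [one_smul, zero_add, X_def]
    rw [← X_pow_eq, map_pow, h1, monomial_pow, one_pow, ← map_nsmul, Finsupp.smul_single_one]

/-- The preimage of `𝔞 ^ α` in the power series ring is contained in the sum of the ideal of
minors and the `α`-th power of the ideal of the first `n - 1` columns. -/
lemma mem_detI2_sup_of_map_mem {K : Type} [Field K] {m n : ℕ}
    (φ : DetR K m n →ₐ[K] DetS K m n) (hφ : IsDetPhi K m n φ) (α : ℕ) (f : DetP K m n)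
    (hf : φ (Ideal.Quotient.mk (detI2 K m n) f) ∈ detA K m n ^ α) :
    f ∈ detI2 K m n ⊔ colIdeal K m n ^ α := by
  classical
  set ψ := φ.comp (Ideal.Quotient.mkₐ K (detI2 K m n))
  set θ := detExp m n
  have hθ : ∀ p, 1 ≤ (θ (Finsupp.single p 1)).degree := fun p => by
    rw [detExp_single, one_smul, map_add, Finsupp.degree_single]
    exact Nat.le_add_left _ _
  have hcoeff := fun t k => coeff_map_eq_sum ψ θ (map_monomial_eq_monomial_detExp φ hφ) hθ f
    (t := t) (k := k)
  have hzero : ∀ t, aDegree m n t < α → coeff t (ψ f) = 0 :=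
    pow_le_weightIdeal _ (detA_le_weightIdeal K m n) α hf
  obtain ⟨N, hN⟩ : ∃ N : (Fin m ⊕ Fin (n - 1) →₀ ℕ) → (Fin m × Fin n →₀ ℕ),
      ∀ e, θ (N (θ e)) = θ e :=
    ⟨Function.invFun θ, fun e => Function.invFun_eq ⟨e, rfl⟩⟩
  refine mem_of_coeff_eq_sum (Submodule.FG.sup (detI2_fg K m n) (colIdeal_fg K m n).pow) (max 2 α)
    (fun e => coeff e f)
    (fun e => monomial e 1 - if α ≤ aDegree m n (θ e) then 0 else monomial (N (θ e)) 1)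
    (fun e => ?_) f fun d => ⟨d.degree + max 2 α + (θ d).degree + 1, by omega, ?_⟩
  · show _ - ite _ _ _ ∈ _
    split_ifs with h
    · rw [sub_zero]
      exact Ideal.mul_mono (Ideal.pow_le_pow_right (by omega)) le_sup_right
        (monomial_mem_varIdeal_pow_mul h)
    · exact Ideal.mul_mono (Ideal.pow_le_pow_right (by omega)) le_sup_left
        (monomial_sub_monomial_mem (minor_mem_detI2 K) _ e (N (θ e)) rfl
          (sum_row_eq_of_detExp_eq (hN e).symm) (sum_col_eq_of_detExp_eq (hN e).symm))
  · simp only [map_sub, mul_sub, Finset.sum_sub_distrib]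
    rw [Finset.sum_eq_single d]
    rotate_left
    · intro e _ he
      rw [coeff_monomial_ne he.symm, mul_zero]
    · intro h
      exact absurd (mem_expBelow.2 (by omega)) h
    rw [coeff_monomial_same, mul_one, eq_comm, sub_eq_self]
    by_cases hd : aDegree m n (θ d) < α ∧ N (θ d) = d
    · rw [← hzero (θ d) hd.1, hcoeff (θ d) (d.degree + max 2 α + (θ d).degree + 1) (by omega)]
      refine Finset.sum_congr rfl fun e _ => ?_
      by_cases he : θ e = θ d
      · rw [if_pos he, he, if_neg (not_le.2 hd.1), hd.2, coeff_monomial_same, mul_one]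
      · rw [if_neg he]
        split_ifs with h
        · simp
        · rw [coeff_monomial_ne, mul_zero]
          intro hde
          exact he (by rw [hde, hN])
    · refine Finset.sum_eq_zero fun e _ => ?_
      split_ifs with h
      · simp
      · rw [coeff_monomial_ne, mul_zero]
        intro hde
        refine hd ⟨?_, ?_⟩
        · rw [hde, hN]
          omega
        · have : θ d = θ e := by rw [hde, hN]
          rw [this, ← hde]

/-- for every `α ≥ 1`, the induced ring homomorphism
`φ^α : R/I^α → S/𝔞^α S` is injective. -/
theorem statement3 (hm : 2 ≤ m) (hn : 2 ≤ n)
    (φ : DetR 𝕜 m n →ₐ[𝕜] DetS 𝕜 m n) (hφ : IsDetPhi 𝕜 m n φ) (α : ℕ) (hα : 1 ≤ α)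
    (hle : detJ 𝕜 m n ^ α ≤ (detA 𝕜 m n ^ α).comap φ.toRingHom) :
    Function.Injective (Ideal.quotientMap (detA 𝕜 m n ^ α) φ.toRingHom hle) := by
  refine Ideal.quotientMap_injective' fun r hr => ?_
  obtain ⟨f, rfl⟩ := Ideal.Quotient.mk_surjective r
  have h := Ideal.mem_map_of_mem (Ideal.Quotient.mk (detI2 𝕜 m n))
    (mem_detI2_sup_of_map_mem φ hφ α f hr)
  rwa [Ideal.map_sup, Ideal.map_quotient_self, bot_sup_eq, Ideal.map_pow, map_colIdeal] at h
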